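/- For every dimension d ≥ 1 there exists a constant C_d' > 0, depending only on d, such that for every cube Q ⊂ ℝ^d with volume |Q|, every N ≥ 1, and every smooth, compactly supported N-particle function u : (ℝ^d)^N → ℂ with ∫_Q ρ > 0: ∑_{j=1}^N ∫_{(ℝ^d)^N} |∇_{x_j} u|² χ_Q(x_j) dx ≥ C_d' · (∫_Q ρ)^{−2/d} · ∫_Q [ρ(x)^{1/2} − ((∫_Q ρ)/|Q|)^{1/2}]₊^{2(d+2)/d} dx, where ρ(x) := ∑_{j=1}^N ∫_{(ℝ^d)^{N−1}} |u(x₁,…,x_{j−1},x,x_{j+1},…,x_N)|² ∏_{k≠j} dx_k. -/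

import Mathlib

open MeasureTheory

noncomputable section

/-- A cube in `ℝ^d`: a set congruent to `(0,L)^d` for some `L > 0`. -/
def IsCube (d : ℕ) (Q : Set (EuclideanSpace ℝ (Fin d))) : Prop :=
  ∃ L : ℝ, 0 < L ∧ ∃ f : EuclideanSpace ℝ (Fin d) ≃ᵢ EuclideanSpace ℝ (Fin d),
    Q = f '' {x : EuclideanSpace ℝ (Fin d) | ∀ m, x m ∈ Set.Ioo 0 L}

/-- One-particle density of an `N`-particle wave function on `(ℝ^d)^N`. -/
def density (d N : ℕ) (u : (Fin N → EuclideanSpace ℝ (Fin d)) → ℂ)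
    (y : EuclideanSpace ℝ (Fin d)) : ℝ :=
  ∑ j : Fin N, ∫ z : {k : Fin N // k ≠ j} → EuclideanSpace ℝ (Fin d),
    ‖u (fun k => if h : k = j then y else z ⟨k, h⟩)‖ ^ 2

/-- A smooth transition from `0` to `1` on the interval `[1, 4]`. -/
theorem exists_contDiff_transition : ∃ (θ : ℝ → ℝ) (M : ℝ), ContDiff ℝ 1 θ ∧ 0 < M ∧
    (∀ r, 0 ≤ θ r) ∧ (∀ r, θ r ≤ 1) ∧ (∀ r ≤ 1, θ r = 0) ∧ (∀ r, 4 ≤ r → θ r = 1) ∧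
    (∀ r, |deriv θ r| ≤ M) ∧ ∀ r, deriv θ r ≠ 0 → r ∈ Set.Ioo (1 : ℝ) 4 := by
  set θ : ℝ → ℝ := fun r => Real.smoothTransition ((r - 1) / 3) with hθ
  have hcd : ContDiff ℝ 1 θ :=
    (Real.smoothTransition.contDiff (n := 1)).comp (by fun_prop)
  have h0 : ∀ r ≤ 1, θ r = 0 := fun r hr =>
    Real.smoothTransition.zero_of_nonpos (by linarith)
  have h1 : ∀ r, 4 ≤ r → θ r = 1 := fun r hr =>
    Real.smoothTransition.one_of_one_le (by linarith)
  have hnn : ∀ r, 0 ≤ θ r := fun r => Real.smoothTransition.nonneg _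
  have hle : ∀ r, θ r ≤ 1 := fun r => Real.smoothTransition.le_one _
  have hsupp : ∀ r, deriv θ r ≠ 0 → r ∈ Set.Ioo (1 : ℝ) 4 := by
    intro r hr
    by_contra hmem
    apply hr
    rcases le_or_gt r 1 with h | h
    · refine IsLocalMin.deriv_eq_zero (Filter.Eventually.of_forall fun z => ?_)
      rw [h0 r h]
      exact hnn z
    · have h4 : 4 ≤ r := by
        by_contra hlt
        exact hmem ⟨h, not_le.1 hlt⟩
      refine IsLocalMax.deriv_eq_zero (Filter.Eventually.of_forall fun z => ?_)
      rw [h1 r h4]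
      exact hle z
  obtain ⟨M, hM⟩ := (isCompact_Icc (a := (1 : ℝ)) (b := 4)).exists_bound_of_continuousOn
    (hcd.continuous_deriv le_rfl).continuousOn
  refine ⟨θ, |M| + 1, hcd, by positivity, hnn, hle, h0, h1, fun r => ?_, hsupp⟩
  by_cases hr : deriv θ r = 0
  · rw [hr, abs_zero]
    positivity
  · exact (hM r (Set.Ioo_subset_Icc_self (hsupp r hr))).trans
      ((le_abs_self M).trans (by linarith))

section Truncation

variable {E : Type*} [NormedAddCommGroup E] [NormedSpace ℝ E]

theorem enorm_fderiv_comp_sq_le {ρ : E → ℝ} (hρ : ContDiff ℝ 1 ρ) {G : E → ENNReal}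
    {y : E} (hG : ‖fderiv ℝ ρ y‖ₑ ^ 2 ≤ ENNReal.ofReal (4 * ρ y) * G y)
    {φ : ℝ → ℝ} {φ' c : ℝ} (hφ : HasDerivAt φ φ' (ρ y)) (hc : φ' ^ 2 * (4 * ρ y) ≤ c) :
    ‖fderiv ℝ (fun y => φ (ρ y)) y‖ₑ ^ 2 ≤ ENNReal.ofReal c * G y := by
  have h := hφ.comp_hasFDerivAt y (hρ.differentiable one_ne_zero y).hasFDerivAt
  have h' : fderiv ℝ (fun y => φ (ρ y)) y = φ' • fderiv ℝ ρ y := h.fderiv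
  rw [h', enorm_smul, mul_pow]
  calc ‖φ'‖ₑ ^ 2 * ‖fderiv ℝ ρ y‖ₑ ^ 2
      ≤ ENNReal.ofReal (φ' ^ 2) * (ENNReal.ofReal (4 * ρ y) * G y) := by
        gcongr
        rw [Real.enorm_eq_ofReal_abs, ← ENNReal.ofReal_pow (abs_nonneg _), sq_abs]
    _ ≤ _ := by
        rw [← mul_assoc, ← ENNReal.ofReal_mul (sq_nonneg _)]
        gcongr

theorem enorm_fderiv_transition_sq_le {ρ : E → ℝ} (hρ : ContDiff ℝ 1 ρ) {G : E → ENNReal}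
    {y : E} (hρ0 : 0 ≤ ρ y) (hG : ‖fderiv ℝ ρ y‖ₑ ^ 2 ≤ ENNReal.ofReal (4 * ρ y) * G y)
    {θ : ℝ → ℝ} {M : ℝ} (hθ : ContDiff ℝ 1 θ) (hθM : ∀ r, |deriv θ r| ≤ M)
    (hθs : ∀ r, deriv θ r ≠ 0 → r ∈ Set.Ioo (1 : ℝ) 4) {l : ℝ} (hlpos : 0 < l) :
    ‖fderiv ℝ (fun y => l * θ (ρ y / l ^ 2)) y‖ₑ ^ 2 ≤
      {y | ρ y ∈ Set.Ioo (l ^ 2) (4 * l ^ 2)}.indicator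
        (fun y => ENNReal.ofReal (16 * M ^ 2) * G y) y := by
  have hd : HasDerivAt (fun r => l * θ (r / l ^ 2)) (l * (deriv θ (ρ y / l ^ 2) * (1 / l ^ 2)))
      (ρ y) :=
    (((hθ.differentiable one_ne_zero _).hasDerivAt).comp (ρ y)
      ((hasDerivAt_id (ρ y)).div_const (l ^ 2))).const_mul l
  by_cases hz : deriv θ (ρ y / l ^ 2) = 0
  · have := enorm_fderiv_comp_sq_le hρ hG hd (c := 0) (by simp [hz])
    refine this.trans ?_
    simp
  · have hmem := hθs _ hz
    rw [Set.mem_Ioo, lt_div_iff₀ (by positivity), div_lt_iff₀ (by positivity), one_mul] at hmem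
    rw [Set.indicator_of_mem (show y ∈ {y | ρ y ∈ Set.Ioo (l ^ 2) (4 * l ^ 2)} from hmem)]
    have h1 : deriv θ (ρ y / l ^ 2) ^ 2 ≤ M ^ 2 :=
      sq_le_sq' (abs_le.1 (hθM _)).1 (abs_le.1 (hθM _)).2
    have h2 : (l * (deriv θ (ρ y / l ^ 2) * (1 / l ^ 2))) ^ 2 * (4 * ρ y) =
        deriv θ (ρ y / l ^ 2) ^ 2 * (4 * (ρ y / l ^ 2)) := by
      field_simp
    have h3 : ρ y / l ^ 2 ≤ 4 := by rw [div_le_iff₀ (by positivity)]; exact hmem.2.le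
    have h4 : 0 ≤ ρ y / l ^ 2 := div_nonneg hρ0 (by positivity)
    have hc : (l * (deriv θ (ρ y / l ^ 2) * (1 / l ^ 2))) ^ 2 * (4 * ρ y) ≤ 16 * M ^ 2 := by
      rw [h2]
      calc _ ≤ M ^ 2 * (4 * 4) := by gcongr
        _ = _ := by ring
    exact enorm_fderiv_comp_sq_le (φ := fun r => l * θ (r / l ^ 2)) hρ hG hd hc

end Truncation

section ConvexPoincare

variable {E : Type*} [NormedAddCommGroup E] [NormedSpace ℝ E] [FiniteDimensional ℝ E]
  [MeasurableSpace E] [BorelSpace E] (μ : Measure E) [μ.IsAddHaarMeasure]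

/-- The image of Lebesgue measure under an affine contraction. -/
theorem lintegral_add_smul_eq (c : E) {τ : ℝ} (hτ : 0 < τ) {F : E → ENNReal}
    (hF : Measurable F) :
    ∫⁻ y, F (c + τ • y) ∂μ =
      ENNReal.ofReal ((τ ^ Module.finrank ℝ E)⁻¹) * ∫⁻ y, F y ∂μ := by
  have h1 : ∫⁻ y, F (c + τ • y) ∂μ = ∫⁻ y, F (c + y) ∂(μ.map (τ • ·)) := by
    rw [lintegral_map (by fun_prop) (measurable_const_smul τ)]
  rw [h1, Measure.map_addHaar_smul μ hτ.ne', lintegral_smul_measure,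
    lintegral_add_left_eq_self (μ := μ) F c, abs_of_pos (by positivity), smul_eq_mul]

theorem Convex.setLIntegral_lineMap_le {Q : Set E} (hQ : Convex ℝ Q) (hQm : MeasurableSet Q)
    {x : E} (hx : x ∈ Q) {τ : ℝ} (hτ : 0 < τ) (hτ1 : τ ≤ 1) {F : E → ENNReal}
    (hF : Measurable F) :
    ∫⁻ y in Q, F ((1 - τ) • x + τ • y) ∂μ ≤
      ENNReal.ofReal ((τ ^ Module.finrank ℝ E)⁻¹) * ∫⁻ y in Q, F y ∂μ := by
  rw [← lintegral_indicator hQm F, ← lintegral_add_smul_eq μ ((1 - τ) • x) hτ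
    (hF.indicator hQm), ← lintegral_indicator hQm]
  refine lintegral_mono fun y => ?_
  by_cases hy : y ∈ Q
  · have : (1 - τ) • x + τ • y ∈ Q := hQ hx hy (by linarith) hτ.le (by ring)
    simp [hy, this]
  · simp [hy]

theorem Convex.setLIntegral_setLIntegral_lineMap_le {Q : Set E} (hQ : Convex ℝ Q)
    (hQm : MeasurableSet Q) {τ : ℝ} (hτ : 0 ≤ τ) (hτ1 : τ ≤ 1)
    {F : E → ENNReal} (hF : Measurable F) :
    ∫⁻ x in Q, ∫⁻ y in Q, F ((1 - τ) • x + τ • y) ∂μ ∂μ ≤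
      2 ^ Module.finrank ℝ E * μ Q * ∫⁻ y in Q, F y ∂μ := by
  have key : ∀ τ : ℝ, 1 / 2 ≤ τ → τ ≤ 1 →
      ∫⁻ x in Q, ∫⁻ y in Q, F ((1 - τ) • x + τ • y) ∂μ ∂μ ≤
      2 ^ Module.finrank ℝ E * μ Q * ∫⁻ y in Q, F y ∂μ := by
    intro τ h1 h2
    have hpos : 0 < τ := by linarith
    have hc : ENNReal.ofReal ((τ ^ Module.finrank ℝ E)⁻¹) ≤ 2 ^ Module.finrank ℝ E := by
      rw [← inv_pow, ENNReal.ofReal_pow (by positivity)]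
      gcongr
      rw [show (2 : ENNReal) = ENNReal.ofReal 2 by simp]
      apply ENNReal.ofReal_le_ofReal
      rw [inv_le_comm₀ hpos (by norm_num)]
      linarith
    calc ∫⁻ x in Q, ∫⁻ y in Q, F ((1 - τ) • x + τ • y) ∂μ ∂μ
        ≤ ∫⁻ x in Q, 2 ^ Module.finrank ℝ E * ∫⁻ y in Q, F y ∂μ ∂μ := by
          refine setLIntegral_mono measurable_const fun x hx => ?_
          exact (hQ.setLIntegral_lineMap_le μ hQm hx hpos h2 hF).trans (by gcongr)
      _ = _ := by
          rw [setLIntegral_const]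
          ring
  rcases le_total (1 / 2) τ with h | h
  · exact key τ h hτ1
  · rw [lintegral_lintegral_swap (by fun_prop)]
    have := key (1 - τ) (by linarith) (by linarith)
    simp only [sub_sub_cancel] at this
    simpa only [add_comm] using this

/-- The fundamental theorem of calculus and the Cauchy–Schwarz inequality on a segment. -/
theorem enorm_sub_sq_le_lintegral_fderiv {v : E → ℝ} (hv : ContDiff ℝ 1 v) (x h : E) :
    ‖v (x + h) - v x‖ₑ ^ 2 ≤
      ‖h‖ₑ ^ 2 * ∫⁻ t in Set.Icc (0 : ℝ) 1, ‖fderiv ℝ v (x + t • h)‖ₑ ^ 2 := by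
  have hd : ContDiff ℝ 1 fun t : ℝ => v (x + t • h) := by fun_prop
  have h1 := enorm_sub_le_lintegral_deriv_of_contDiffOn_Icc (a := 0) (b := 1)
    hd.contDiffOn zero_le_one
  simp only [one_smul, zero_smul, add_zero] at h1
  have hder : ∀ t : ℝ, deriv (fun t : ℝ => v (x + t • h)) t = fderiv ℝ v (x + t • h) h := by
    intro t
    have h2 : HasDerivAt (fun t : ℝ => x + t • h) h t := by
      simpa using ((hasDerivAt_id t).smul_const h).const_add x
    exact ((hv.differentiable one_ne_zero (x + t • h)).hasFDerivAt.comp_hasDerivAt t h2).deriv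
  have hcont : Continuous fun t : ℝ => fderiv ℝ v (x + t • h) :=
    (hv.continuous_fderiv one_ne_zero).comp (by fun_prop)
  set ν := volume.restrict (Set.Icc (0 : ℝ) 1) with hν
  have hprob : IsProbabilityMeasure ν := ⟨by simp [hν]⟩
  have h3 : ∫⁻ t in Set.Icc (0 : ℝ) 1, ‖deriv (fun t : ℝ => v (x + t • h)) t‖ₑ ≤
      ‖h‖ₑ * ∫⁻ t in Set.Icc (0 : ℝ) 1, ‖fderiv ℝ v (x + t • h)‖ₑ := by
    rw [← lintegral_const_mul _ (by fun_prop)]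
    refine lintegral_mono fun t => ?_
    rw [hder, mul_comm]
    exact ContinuousLinearMap.le_opENorm _ _
  have h4 : (∫⁻ t, ‖fderiv ℝ v (x + t • h)‖ₑ ∂ν) ^ 2 ≤
      ∫⁻ t, ‖fderiv ℝ v (x + t • h)‖ₑ ^ 2 ∂ν := by
    have := eLpNorm_le_eLpNorm_of_exponent_le (μ := ν) (p := 1) (q := 2) (by norm_num)
      hcont.aestronglyMeasurable
    rw [eLpNorm_one_eq_lintegral_enorm] at this
    refine (pow_le_pow_left' this 2).trans (le_of_eq ?_)
    have h5 := eLpNorm_nnreal_pow_eq_lintegral (μ := ν) (p := 2)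
      (f := fun t : ℝ => fderiv ℝ v (x + t • h)) two_ne_zero
    simpa using h5
  calc _ ≤ (‖h‖ₑ * ∫⁻ t, ‖fderiv ℝ v (x + t • h)‖ₑ ∂ν) ^ 2 := by
        gcongr
        exact h1.trans h3
    _ ≤ _ := by
        rw [mul_pow]
        gcongr

/-- A Poincaré inequality for the increments of a function towards the points of a convex set. -/
theorem Convex.setLIntegral_setLIntegral_sub_lineMap_le {Q : Set E} (hQ : Convex ℝ Q)
    (hQm : MeasurableSet Q) {D : ℝ} (hD : ∀ x ∈ Q, ∀ y ∈ Q, ‖y - x‖ ≤ D)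
    {s : ℝ} (hs : 0 ≤ s) (hs1 : s ≤ 1) {v : E → ℝ} (hv : ContDiff ℝ 1 v) :
    ∫⁻ x in Q, ∫⁻ y in Q, ‖v ((1 - s) • x + s • y) - v x‖ₑ ^ 2 ∂μ ∂μ ≤
      ENNReal.ofReal (s * D) ^ 2 *
        (2 ^ Module.finrank ℝ E * μ Q * ∫⁻ y in Q, ‖fderiv ℝ v y‖ₑ ^ 2 ∂μ) := by
  have hcd := hv.continuous_fderiv one_ne_zero
  set G : E → ENNReal := fun y => ‖fderiv ℝ v y‖ₑ ^ 2 with hG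
  have hGm : Measurable G := by fun_prop
  calc ∫⁻ x in Q, ∫⁻ y in Q, ‖v ((1 - s) • x + s • y) - v x‖ₑ ^ 2 ∂μ ∂μ
      ≤ ∫⁻ x in Q, ∫⁻ y in Q, ENNReal.ofReal (s * D) ^ 2 *
          (∫⁻ t in Set.Icc (0 : ℝ) 1, G ((1 - t * s) • x + (t * s) • y)) ∂μ ∂μ := by
        refine setLIntegral_mono' hQm fun x hx => setLIntegral_mono' hQm fun y hy => ?_
        have := enorm_sub_sq_le_lintegral_fderiv hv x (s • (y - x))
        rw [show x + s • (y - x) = (1 - s) • x + s • y by module] at this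
        refine this.trans ?_
        gcongr with t
        · rw [← ofReal_norm, norm_smul, Real.norm_of_nonneg hs]
          exact ENNReal.ofReal_le_ofReal (by gcongr; exact hD x hx y hy)
        · rw [hG, show (1 - t * s) • x + (t * s) • y = x + t • s • (y - x) by module]
    _ = ENNReal.ofReal (s * D) ^ 2 * ∫⁻ t in Set.Icc (0 : ℝ) 1, ∫⁻ x in Q, ∫⁻ y in Q,
          G ((1 - t * s) • x + (t * s) • y) ∂μ ∂μ := by
        have e1 : ∀ x, ∫⁻ y in Q, ENNReal.ofReal (s * D) ^ 2 *
          (∫⁻ t in Set.Icc (0 : ℝ) 1, G ((1 - t * s) • x + (t * s) • y)) ∂μ =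
          ENNReal.ofReal (s * D) ^ 2 *
          ∫⁻ t in Set.Icc (0 : ℝ) 1, ∫⁻ y in Q, G ((1 - t * s) • x + (t * s) • y) ∂μ := by
          intro x
          rw [lintegral_const_mul' _ _ (by finiteness), lintegral_lintegral_swap (by fun_prop)]
        simp_rw [e1]
        rw [lintegral_const_mul' _ _ (by finiteness), lintegral_lintegral_swap]
        have : Measurable fun p : (E × ℝ) × E =>
            G ((1 - p.1.2 * s) • p.1.1 + (p.1.2 * s) • p.2) := by fun_prop
        exact (this.lintegral_prod_right' (ν := μ.restrict Q)).aemeasurable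
    _ ≤ ENNReal.ofReal (s * D) ^ 2 * ∫⁻ t in Set.Icc (0 : ℝ) 1,
          2 ^ Module.finrank ℝ E * μ Q * ∫⁻ y in Q, G y ∂μ := by
        refine mul_le_mul' le_rfl ?_
        refine setLIntegral_mono' measurableSet_Icc fun t ht => ?_
        exact hQ.setLIntegral_setLIntegral_lineMap_le μ hQm (mul_nonneg ht.1 hs)
          (mul_le_one₀ ht.2 hs hs1) hGm
    _ = _ := by simp

/-- The part of a function above a multiple of its root mean square is controlled
by its gradient. -/
theorem Convex.setLIntegral_sub_posPart_sq_le {Q : Set E} (hQ : Convex ℝ Q)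
    (hQm : MeasurableSet Q) (hQ0 : μ Q ≠ 0) (hQt : μ Q ≠ ⊤)
    {D : ℝ} (hD : ∀ x ∈ Q, ∀ y ∈ Q, ‖y - x‖ ≤ D)
    {s b : ℝ} (hs : 0 < s) (hs1 : s ≤ 1) (hb : 0 < b) {v : E → ℝ} (hv : ContDiff ℝ 1 v)
    (hv2 : ∫⁻ y in Q, ENNReal.ofReal (v y ^ 2) ∂μ ≤
      ENNReal.ofReal (s ^ Module.finrank ℝ E * b ^ 2) * μ Q) :
    ∫⁻ x in Q, ENNReal.ofReal (max (v x - b) 0 ^ 2) ∂μ ≤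
      ENNReal.ofReal (s * D) ^ 2 *
        (2 ^ Module.finrank ℝ E * ∫⁻ y in Q, ‖fderiv ℝ v y‖ₑ ^ 2 ∂μ) := by
  have hvm := hv.continuous.measurable
  have key : ∀ x ∈ Q, μ Q * ENNReal.ofReal (max (v x - b) 0 ^ 2) ≤
      ∫⁻ y in Q, ‖v ((1 - s) • x + s • y) - v x‖ₑ ^ 2 ∂μ := by
    intro x hx
    rcases le_or_gt (v x) b with hm | hm
    · simp [max_eq_right (sub_nonpos.2 hm)]
    set m := v x with hmdef
    have hmb : 0 ≤ m / b - 1 := by rw [sub_nonneg, le_div_iff₀ hb]; linarith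
    have h1 : ∫⁻ y in Q, ENNReal.ofReal (v ((1 - s) • x + s • y) ^ 2) ∂μ ≤
        ENNReal.ofReal (b ^ 2) * μ Q := by
      refine (hQ.setLIntegral_lineMap_le μ hQm hx hs hs1
        (F := fun y => ENNReal.ofReal (v y ^ 2)) (by fun_prop)).trans ?_
      refine (mul_le_mul_right hv2 _).trans (le_of_eq ?_)
      rw [← mul_assoc, ← ENNReal.ofReal_mul (by positivity), ← mul_assoc,
        inv_mul_cancel₀ (by positivity), one_mul]
    have h2 : μ Q * ENNReal.ofReal (m ^ 2 - m * b) ≤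
        ∫⁻ y in Q, ‖v ((1 - s) • x + s • y) - m‖ₑ ^ 2 ∂μ +
        ENNReal.ofReal (m / b - 1) * ∫⁻ y in Q, ENNReal.ofReal (v ((1 - s) • x + s • y) ^ 2) ∂μ := by
      rw [← lintegral_const_mul _ (by fun_prop), ← lintegral_add_left (by fun_prop),
        mul_comm, ← setLIntegral_const]
      refine lintegral_mono fun y => ?_
      set z := v ((1 - s) • x + s • y)
      rw [← ENNReal.ofReal_mul hmb, Real.enorm_eq_ofReal_abs, ← ENNReal.ofReal_pow (abs_nonneg _),
        sq_abs, ← ENNReal.ofReal_add (by positivity) (by positivity)]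
      apply ENNReal.ofReal_le_ofReal
      have : (z - m) ^ 2 + (m / b - 1) * z ^ 2 - (m ^ 2 - m * b) = m / b * (z - b) ^ 2 := by
        field_simp
        ring
      have h0 : 0 ≤ m / b * (z - b) ^ 2 := mul_nonneg (by linarith) (sq_nonneg _)
      linarith
    have h3 : μ Q * ENNReal.ofReal (m ^ 2 - m * b) =
        μ Q * ENNReal.ofReal (max (m - b) 0 ^ 2) +
          ENNReal.ofReal (m / b - 1) * (ENNReal.ofReal (b ^ 2) * μ Q) := by
      rw [← mul_assoc, ← ENNReal.ofReal_mul hmb, mul_comm (ENNReal.ofReal _) (μ Q), ← mul_add,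
        ← ENNReal.ofReal_add (by positivity) (by positivity), max_eq_left (by linarith)]
      congr 2
      field_simp
      ring
    rw [h3] at h2
    refine ENNReal.le_of_add_le_add_right
      (a := ENNReal.ofReal (m / b - 1) * (ENNReal.ofReal (b ^ 2) * μ Q)) (by finiteness) ?_
    exact h2.trans (by gcongr)
  have h4 := (setLIntegral_mono' hQm key).trans
    (hQ.setLIntegral_setLIntegral_sub_lineMap_le μ hQm hD hs.le hs1 hv)
  rw [lintegral_const_mul' _ _ hQt] at h4
  rw [← ENNReal.mul_le_mul_iff_right hQ0 hQt]
  refine h4.trans (le_of_eq ?_)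
  ring

variable {Q : Set E} {D a : ℝ} {ρ : E → ℝ} {G : E → ENNReal}

/-- The excess of `√ρ` over its root mean square in `L²`. -/
theorem Convex.setLIntegral_sqrt_sub_posPart_sq_le (hQ : Convex ℝ Q)
    (hQm : MeasurableSet Q) (hQ0 : μ Q ≠ 0) (hQt : μ Q ≠ ⊤)
    (hD : ∀ x ∈ Q, ∀ y ∈ Q, ‖y - x‖ ≤ D) (ha : 0 < a)
    (hρ : ContDiff ℝ 1 ρ) (hρ0 : ∀ y, 0 ≤ ρ y)
    (hG : ∀ y, ‖fderiv ℝ ρ y‖ₑ ^ 2 ≤ ENNReal.ofReal (4 * ρ y) * G y)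
    (hρa : ∫⁻ y in Q, ENNReal.ofReal (ρ y) ∂μ = ENNReal.ofReal (a ^ 2) * μ Q) :
    ∫⁻ x in Q, ENNReal.ofReal (max (√(ρ x) - a) 0 ^ 2) ∂μ ≤
      ENNReal.ofReal (4 * 2 ^ Module.finrank ℝ E * D ^ 2) * ∫⁻ y in Q, G y ∂μ := by
  have hρm := hρ.continuous.measurable
  have hpos : ∀ y, 0 < ρ y + a ^ 2 := fun y => by have := hρ0 y; positivity
  have hs2 : (√2 : ℝ) ^ 2 = 2 := Real.sq_sqrt (by norm_num)
  have hw : ContDiff ℝ 1 fun y => √(ρ y + a ^ 2) :=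
    (hρ.add contDiff_const).sqrt fun y => (hpos y).ne'
  have hD0 : 0 ≤ D := by
    obtain ⟨x, hx⟩ := nonempty_of_measure_ne_zero hQ0
    simpa using hD x hx x hx
  have h := hQ.setLIntegral_sub_posPart_sq_le μ hQm hQ0 hQt hD zero_lt_one le_rfl
    (b := √2 * a) (by positivity) hw (by
      simp_rw [Real.sq_sqrt (hpos _).le]
      have : ∀ y, ENNReal.ofReal (ρ y + a ^ 2) = ENNReal.ofReal (ρ y) + ENNReal.ofReal (a ^ 2) :=
        fun y => ENNReal.ofReal_add (hρ0 y) (sq_nonneg a)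
      simp_rw [this]
      rw [lintegral_add_right _ measurable_const, hρa, setLIntegral_const, ← add_mul,
        ← ENNReal.ofReal_add (sq_nonneg a) (sq_nonneg a), one_pow, one_mul, mul_pow, hs2, two_mul])
  have hgrad : ∀ y, ‖fderiv ℝ (fun y => √(ρ y + a ^ 2)) y‖ₑ ^ 2 ≤ G y := by
    intro y
    have hd : HasDerivAt (fun r => √(r + a ^ 2)) (1 / (2 * √(ρ y + a ^ 2))) (ρ y) :=
      ((hasDerivAt_id (ρ y)).add_const (a ^ 2)).sqrt (hpos y).ne'
    have := enorm_fderiv_comp_sq_le hρ (hG y) hd (c := 1) (by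
      rw [div_pow, mul_pow, Real.sq_sqrt (hpos y).le, div_mul_eq_mul_div,
        div_le_one (by have := hpos y; positivity)]
      nlinarith [sq_nonneg a])
    simpa using this
  have hpt : ∀ x, ENNReal.ofReal (max (√(ρ x) - a) 0 ^ 2) ≤
      4 * ENNReal.ofReal (max (√(ρ x + a ^ 2) - √2 * a) 0 ^ 2) := by
    intro x
    rw [show (4 : ENNReal) = ENNReal.ofReal 4 by simp, ← ENNReal.ofReal_mul (by norm_num)]
    apply ENNReal.ofReal_le_ofReal
    set g := √(ρ x) with hg
    have hg2 : ρ x = g ^ 2 := (Real.sq_sqrt (hρ0 x)).symm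
    rw [hg2]
    rcases le_or_gt g a with h1 | h1
    · rw [max_eq_right (by linarith), zero_pow two_ne_zero]
      positivity
    set w := √(g ^ 2 + a ^ 2) with hwdef
    have hw2 : w ^ 2 = g ^ 2 + a ^ 2 := Real.sq_sqrt (by positivity)
    have hwnn : 0 ≤ w := Real.sqrt_nonneg _
    have hle : (g - a) / 2 ≤ w - √2 * a := by
      have h2 : √2 ≤ 3 / 2 := Real.sqrt_le_iff.2 ⟨by norm_num, by norm_num⟩
      have : (√2 * a + (g - a) / 2) ≤ w := by
        apply Real.le_sqrt_of_sq_le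
        nlinarith [mul_pos ha (sub_pos.2 h1), sq_nonneg (g - a)]
      linarith
    rw [max_eq_left (by linarith), max_eq_left (by linarith)]
    nlinarith
  calc _ ≤ ∫⁻ x in Q, 4 * ENNReal.ofReal (max (√(ρ x + a ^ 2) - √2 * a) 0 ^ 2) ∂μ :=
        lintegral_mono hpt
    _ ≤ 4 * (ENNReal.ofReal (1 * D) ^ 2 * (2 ^ Module.finrank ℝ E * ∫⁻ y in Q, G y ∂μ)) := by
        rw [lintegral_const_mul' _ _ (by finiteness)]
        gcongr
        refine h.trans ?_
        gcongr with y
        exact hgrad y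
    _ = _ := by
        rw [one_mul, ENNReal.ofReal_mul (by positivity), ENNReal.ofReal_mul (by norm_num),
          ENNReal.ofReal_pow hD0, ENNReal.ofReal_pow (by norm_num)]
        simp only [ENNReal.ofReal_ofNat]
        ring

/-- A weak-type bound on the superlevel sets of `ρ`, with the gradient on a level band only. -/
theorem Convex.measure_superlevel_le (hQ : Convex ℝ Q)
    (hQm : MeasurableSet Q) (hQ0 : μ Q ≠ 0) (hQt : μ Q ≠ ⊤) (hn : 0 < Module.finrank ℝ E)
    (hD : ∀ x ∈ Q, ∀ y ∈ Q, ‖y - x‖ ≤ D) (ha : 0 < a)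
    (hρ : ContDiff ℝ 1 ρ) (hρ0 : ∀ y, 0 ≤ ρ y)
    (hG : ∀ y, ‖fderiv ℝ ρ y‖ₑ ^ 2 ≤ ENNReal.ofReal (4 * ρ y) * G y)
    (hρa : ∫⁻ y in Q, ENNReal.ofReal (ρ y) ∂μ = ENNReal.ofReal (a ^ 2) * μ Q)
    {θ : ℝ → ℝ} {M : ℝ} (hθ : ContDiff ℝ 1 θ) (hθ0 : ∀ r, 0 ≤ θ r)
    (hθ1 : ∀ r, θ r ≤ 1) (hθz : ∀ r ≤ 1, θ r = 0) (hθo : ∀ r, 4 ≤ r → θ r = 1)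
    (hθM : ∀ r, |deriv θ r| ≤ M) (hθs : ∀ r, deriv θ r ≠ 0 → r ∈ Set.Ioo (1 : ℝ) 4)
    {l : ℝ} (hl : 2 * a ≤ l) :
    ENNReal.ofReal (l ^ (2 + 4 / (Module.finrank ℝ E : ℝ))) *
        μ.restrict Q {x | 4 * l ^ 2 ≤ ρ x} ≤
      ENNReal.ofReal (64 * M ^ 2 * 2 ^ Module.finrank ℝ E *
          (2 * a) ^ (4 / (Module.finrank ℝ E : ℝ)) * D ^ 2) *
        ∫⁻ y in {y | ρ y ∈ Set.Ioo (l ^ 2) (4 * l ^ 2)}, G y ∂(μ.restrict Q) := by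
  have hρm := hρ.continuous.measurable
  set n := Module.finrank ℝ E with hndef
  have hnR : (0 : ℝ) < n := by exact_mod_cast hn
  have hlpos : 0 < l := by linarith
  have hD0 : 0 ≤ D := by
    obtain ⟨x, hx⟩ := nonempty_of_measure_ne_zero hQ0
    simpa using hD x hx x hx
  set s : ℝ := (2 * a / l) ^ (2 / (n : ℝ)) with hs
  have hspos : 0 < s := by positivity
  have hs1 : s ≤ 1 := Real.rpow_le_one (by positivity) (by rwa [div_le_one hlpos]) (by positivity)
  have hsn : s ^ n = (2 * a / l) ^ 2 := by
    rw [hs, ← Real.rpow_natCast, ← Real.rpow_mul (by positivity), div_mul_cancel₀ _ hnR.ne']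
    exact Real.rpow_natCast _ 2
  have hs2 : s ^ 2 * l ^ (4 / (n : ℝ)) = (2 * a) ^ (4 / (n : ℝ)) := by
    rw [hs, ← Real.rpow_natCast, ← Real.rpow_mul (by positivity),
      show 2 / (n : ℝ) * ((2 : ℕ) : ℝ) = 4 / n by push_cast; ring,
      Real.div_rpow (by positivity) hlpos.le, div_mul_cancel₀ _ (by positivity)]
  set v : E → ℝ := fun y => l * θ (ρ y / l ^ 2) with hv
  have hvcd : ContDiff ℝ 1 v := contDiff_const.mul (hθ.comp (hρ.div_const _))
  have hvρ : ∀ y, v y ^ 2 ≤ ρ y := by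
    intro y
    rcases le_or_gt (ρ y / l ^ 2) 1 with h | h
    · simp [hv, hθz _ h, hρ0 y]
    · rw [lt_div_iff₀ (by positivity), one_mul] at h
      rw [hv, mul_pow]
      have : θ (ρ y / l ^ 2) ^ 2 ≤ 1 := pow_le_one₀ (hθ0 _) (hθ1 _)
      nlinarith [sq_nonneg l]
  have h := hQ.setLIntegral_sub_posPart_sq_le μ hQm hQ0 hQt hD hspos hs1
    (b := l / 2) (by positivity) hvcd (by
      rw [← hndef, hsn, show (2 * a / l) ^ 2 * (l / 2) ^ 2 = a ^ 2 by field_simp, ← hρa]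
      exact lintegral_mono fun y => ENNReal.ofReal_le_ofReal (hvρ y))
  set A : Set E := {y | ρ y ∈ Set.Ioo (l ^ 2) (4 * l ^ 2)} with hA
  have hAm : MeasurableSet A := hρm measurableSet_Ioo
  have hgrad : ∀ y, ‖fderiv ℝ v y‖ₑ ^ 2 ≤
      A.indicator (fun y => ENNReal.ofReal (16 * M ^ 2) * G y) y := fun y =>
    enorm_fderiv_transition_sq_le hρ (hρ0 y) (hG y) hθ hθM hθs hlpos
  have hB : MeasurableSet {x | 4 * l ^ 2 ≤ ρ x} := hρm measurableSet_Ici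
  have hlow : ENNReal.ofReal (l ^ 2 / 4) * μ.restrict Q {x | 4 * l ^ 2 ≤ ρ x} ≤
      ∫⁻ x in Q, ENNReal.ofReal (max (v x - l / 2) 0 ^ 2) ∂μ := by
    rw [← lintegral_indicator_const hB]
    refine lintegral_mono fun x => ?_
    by_cases hx : x ∈ {x | 4 * l ^ 2 ≤ ρ x}
    · rw [Set.indicator_of_mem hx]
      have : v x = l := by
        simp only [hv]
        rw [hθo _ (by rwa [le_div_iff₀ (by positivity)]), mul_one]
      rw [this, max_eq_left (by linarith)]
      apply ENNReal.ofReal_le_ofReal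
      linarith [sq_nonneg l]
    · simp [hx]
  have hup : ∫⁻ y in Q, ‖fderiv ℝ v y‖ₑ ^ 2 ∂μ ≤
      ENNReal.ofReal (16 * M ^ 2) * ∫⁻ y in A, G y ∂(μ.restrict Q) := by
    refine (lintegral_mono hgrad).trans (le_of_eq ?_)
    rw [lintegral_indicator hAm, lintegral_const_mul' _ _ (by finiteness)]
  calc _ = ENNReal.ofReal (4 * l ^ (4 / (n : ℝ))) *
        (ENNReal.ofReal (l ^ 2 / 4) * μ.restrict Q {x | 4 * l ^ 2 ≤ ρ x}) := by
        rw [← mul_assoc, ← ENNReal.ofReal_mul (by positivity), Real.rpow_add hlpos, Real.rpow_two]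
        congr 2
        ring
    _ ≤ ENNReal.ofReal (4 * l ^ (4 / (n : ℝ))) * (ENNReal.ofReal (s * D) ^ 2 * (2 ^ n *
          (ENNReal.ofReal (16 * M ^ 2) * ∫⁻ y in A, G y ∂(μ.restrict Q)))) := by
        exact mul_le_mul' le_rfl (hlow.trans (h.trans
          (mul_le_mul' le_rfl (mul_le_mul' le_rfl hup))))
    _ = _ := by
        rw [← hs2, show (2 : ENNReal) ^ n = ENNReal.ofReal (2 ^ n) by
          rw [ENNReal.ofReal_pow (by norm_num), ENNReal.ofReal_ofNat],
          ← ENNReal.ofReal_pow (by positivity), ← mul_assoc, ← mul_assoc, ← mul_assoc,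
          ← ENNReal.ofReal_mul (by positivity), ← ENNReal.ofReal_mul (by positivity),
          ← ENNReal.ofReal_mul (by positivity)]
        congr 2
        ring

/-- The Gagliardo–Nirenberg-type inequality for `√ρ` on a bounded convex set. -/
theorem exists_setLIntegral_sqrt_sub_posPart_rpow_le (n : ℕ) (hn : 0 < n) :
    ∃ K : ℝ, 0 < K ∧ ∀ {E : Type*} [NormedAddCommGroup E] [NormedSpace ℝ E]
      [FiniteDimensional ℝ E] [MeasurableSpace E] [BorelSpace E] (μ : Measure E)
      [μ.IsAddHaarMeasure] (_ : Module.finrank ℝ E = n) {Q : Set E} {D a : ℝ} {ρ : E → ℝ}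
      {G : E → ENNReal} (_ : Convex ℝ Q) (_ : MeasurableSet Q) (_ : μ Q ≠ 0) (_ : μ Q ≠ ⊤)
      (_ : ∀ x ∈ Q, ∀ y ∈ Q, ‖y - x‖ ≤ D) (_ : 0 < a)
      (_ : ContDiff ℝ 1 ρ) (_ : ∀ y, 0 ≤ ρ y)
      (_ : ∀ y, ‖fderiv ℝ ρ y‖ₑ ^ 2 ≤ ENNReal.ofReal (4 * ρ y) * G y)
      (_ : ∫⁻ y in Q, ENNReal.ofReal (ρ y) ∂μ = ENNReal.ofReal (a ^ 2) * μ Q),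
      ∫⁻ x in Q, ENNReal.ofReal (max (√(ρ x) - a) 0 ^ (2 + 4 / (n : ℝ))) ∂μ ≤
        ENNReal.ofReal (K * a ^ (4 / (n : ℝ)) * D ^ 2) * ∫⁻ y in Q, G y ∂μ := by
  obtain ⟨θ, M, hθ, hM, hθ0, hθ1, hθz, hθo, hθM, hθs⟩ := exists_contDiff_transition
  have hnR : (0 : ℝ) < n := by exact_mod_cast hn
  set c : ℝ := 4 / (n : ℝ) with hc
  have hcpos : 0 < c := by positivity
  set p : ℝ := 2 + c with hp
  refine ⟨3 ^ c * (4 * 2 ^ n) + 4 ^ p * (64 * M ^ 2 * 2 ^ n * 2 ^ c), by positivity, ?_⟩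
  intro E _ _ _ _ _ μ _ hfr Q D a ρ G hQ hQm hQ0 hQt hD ha hρ hρ0 hG hρa
  have hρm := hρ.continuous.measurable
  set l : ℕ → ℝ := fun j => 2 ^ (j + 1) * a with hl
  have hlpos : ∀ j, 0 < l j := fun j => by positivity
  have hl2 : ∀ j, 2 * a ≤ l j := by
    intro j
    have : (2 : ℝ) ≤ 2 ^ (j + 1) := by
      rw [pow_succ]
      linarith [one_le_pow₀ (n := j) (one_le_two : (1 : ℝ) ≤ 2)]
    simp only [hl]
    gcongr
  set A : ℕ → Set E := fun j => {y | ρ y ∈ Set.Ioo (l j ^ 2) (4 * l j ^ 2)} with hA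
  have hAm : ∀ j, MeasurableSet (A j) := fun j => hρm measurableSet_Ioo
  have hAd : Pairwise (Function.onFun Disjoint A) := by
    have key : ∀ i j, i < j → Disjoint (A i) (A j) := by
      intro i j hij
      rw [Set.disjoint_left]
      rintro y ⟨-, h1⟩ ⟨h2, -⟩
      have h3 : 2 * l i ≤ l j := by
        have : (2 : ℝ) ^ (i + 1 + 1) ≤ 2 ^ (j + 1) :=
          pow_le_pow_right₀ (by norm_num) (by omega)
        simp only [hl]
        calc 2 * (2 ^ (i + 1) * a) = 2 ^ (i + 1 + 1) * a := by ring
          _ ≤ _ := by gcongr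
      nlinarith [hlpos i, hlpos j]
    intro i j hij
    rcases lt_or_gt_of_ne hij with h | h
    · exact key i j h
    · exact (key j i h).symm
  set B : ℕ → Set E := fun j => {x | 4 * l j ^ 2 ≤ ρ x} with hB
  have hBm : ∀ j, MeasurableSet (B j) := fun j => hρm measurableSet_Ici
  have hpt : ∀ x, ENNReal.ofReal (max (√(ρ x) - a) 0 ^ p) ≤
      ENNReal.ofReal ((3 * a) ^ c) * ENNReal.ofReal (max (√(ρ x) - a) 0 ^ 2) +
      ∑' j, (B j).indicator (fun _ => ENNReal.ofReal (4 ^ p) * ENNReal.ofReal (l j ^ p)) x := by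
    intro x
    set g := √(ρ x) with hg
    have hg0 : 0 ≤ g := Real.sqrt_nonneg _
    have hg2 : g ^ 2 = ρ x := Real.sq_sqrt (hρ0 x)
    rcases le_or_gt g (4 * a) with h | h
    · refine le_add_right ?_
      rw [← ENNReal.ofReal_mul (by positivity)]
      apply ENNReal.ofReal_le_ofReal
      have hm : max (g - a) 0 ≤ 3 * a := max_le (by linarith) (by positivity)
      rw [hp, Real.rpow_add' (by positivity) (by positivity), Real.rpow_two, mul_comm]
      gcongr
    · refine le_add_left ?_
      obtain ⟨j, hj1, hj2⟩ := exists_nat_pow_near (x := g / (4 * a)) (y := 2)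
        (by rw [le_div_iff₀ (by positivity)]; linarith) one_lt_two
      rw [le_div_iff₀ (by positivity)] at hj1
      rw [div_lt_iff₀ (by positivity)] at hj2
      have hxB : x ∈ B j := by
        have : 2 * l j ≤ g := by simp only [hl]; rw [pow_succ]; linarith
        change 4 * l j ^ 2 ≤ ρ x
        nlinarith [hlpos j]
      refine le_trans ?_ (ENNReal.le_tsum j)
      rw [Set.indicator_of_mem hxB, ← ENNReal.ofReal_mul (by positivity),
        ← Real.mul_rpow (by norm_num) (hlpos j).le]
      apply ENNReal.ofReal_le_ofReal
      apply Real.rpow_le_rpow (le_max_right _ _) _ (by positivity)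
      refine max_le ?_ (by have := hlpos j; positivity)
      simp only [hl]
      linarith
  have hlevel : ∀ j, ENNReal.ofReal (l j ^ p) * μ.restrict Q (B j) ≤
      ENNReal.ofReal (64 * M ^ 2 * 2 ^ n * (2 * a) ^ c * D ^ 2) *
        ∫⁻ y in A j, G y ∂(μ.restrict Q) := by
    intro j
    subst hfr
    exact hQ.measure_superlevel_le μ hQm hQ0 hQt hn hD ha hρ hρ0 hG hρa hθ hθ0 hθ1 hθz hθo
      hθM hθs (hl2 j)
  have hfirst := hQ.setLIntegral_sqrt_sub_posPart_sq_le μ hQm hQ0 hQt hD ha hρ hρ0 hG hρa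
  rw [hfr] at hfirst
  calc _ ≤ ∫⁻ x in Q, (ENNReal.ofReal ((3 * a) ^ c) * ENNReal.ofReal (max (√(ρ x) - a) 0 ^ 2) +
      ∑' j, (B j).indicator
        (fun _ => ENNReal.ofReal (4 ^ p) * ENNReal.ofReal (l j ^ p)) x) ∂μ := lintegral_mono hpt
    _ = ENNReal.ofReal ((3 * a) ^ c) * ∫⁻ x in Q, ENNReal.ofReal (max (√(ρ x) - a) 0 ^ 2) ∂μ +
      ∑' j, ENNReal.ofReal (4 ^ p) * (ENNReal.ofReal (l j ^ p) * μ.restrict Q (B j)) := by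
        rw [lintegral_add_left (by fun_prop), lintegral_const_mul' _ _ (by finiteness),
          lintegral_tsum fun j => (measurable_const.indicator (hBm j)).aemeasurable]
        congr 2
        ext j
        rw [lintegral_indicator_const (hBm j), mul_assoc]
    _ ≤ ENNReal.ofReal ((3 * a) ^ c) *
          (ENNReal.ofReal (4 * 2 ^ n * D ^ 2) * ∫⁻ y in Q, G y ∂μ) +
      ∑' j, ENNReal.ofReal (4 ^ p) *
        (ENNReal.ofReal (64 * M ^ 2 * 2 ^ n * (2 * a) ^ c * D ^ 2) *
          ∫⁻ y in A j, G y ∂(μ.restrict Q)) := by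
        exact add_le_add (mul_le_mul' le_rfl hfirst)
          (ENNReal.tsum_le_tsum fun j => mul_le_mul' le_rfl (hlevel j))
    _ ≤ ENNReal.ofReal ((3 * a) ^ c) *
          (ENNReal.ofReal (4 * 2 ^ n * D ^ 2) * ∫⁻ y in Q, G y ∂μ) +
        ENNReal.ofReal (4 ^ p) *
        (ENNReal.ofReal (64 * M ^ 2 * 2 ^ n * (2 * a) ^ c * D ^ 2) * ∫⁻ y in Q, G y ∂μ) := by
        rw [ENNReal.tsum_mul_left, ENNReal.tsum_mul_left, ← lintegral_iUnion hAm hAd]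
        exact add_le_add le_rfl (mul_le_mul' le_rfl (mul_le_mul' le_rfl
          (setLIntegral_le_lintegral _ _)))
    _ = _ := by
        rw [← mul_assoc, ← mul_assoc, ← ENNReal.ofReal_mul (by positivity),
          ← ENNReal.ofReal_mul (by positivity), ← add_mul,
          ← ENNReal.ofReal_add (by positivity) (by positivity),
          Real.mul_rpow (by norm_num) ha.le, Real.mul_rpow (by norm_num) ha.le]
        congr 2
        ring

end ConvexPoincare

theorem HasCompactSupport.comp_prodMk_left {X Y H : Type*} [TopologicalSpace X]
    [TopologicalSpace Y] [R1Space Y] [Zero H] {F : X × Y → H} (hc : HasCompactSupport F) (y : X) :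
    HasCompactSupport fun z => F (y, z) :=
  HasCompactSupport.intro (hc.isCompact.image continuous_snd) fun z hz => by
    by_contra h
    exact hz ⟨(y, z), subset_tsupport F h, rfl⟩

theorem HasCompactSupport.norm_sq {X H : Type*} [TopologicalSpace X] [NormedAddCommGroup H]
    {f : X → H} (hc : HasCompactSupport f) : HasCompactSupport fun p => ‖f p‖ ^ 2 :=
  hc.comp_left (g := fun w => ‖w‖ ^ 2) (by simp)

theorem HasCompactSupport.fderiv_apply_const {X H : Type*} [NormedAddCommGroup X]
    [NormedSpace ℝ X] [NormedAddCommGroup H] [NormedSpace ℝ H] {f : X → H}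
    (hc : HasCompactSupport f) (w : X) : HasCompactSupport fun p => fderiv ℝ f p w :=
  (hc.fderiv ℝ).comp_left (g := fun A : X →L[ℝ] H => A w) (by simp)

section ParametricIntegral

variable {E Z : Type*} [NormedAddCommGroup E] [NormedSpace ℝ E] [FiniteDimensional ℝ E]
  [NormedAddCommGroup Z] [NormedSpace ℝ Z] [FiniteDimensional ℝ Z]
  [MeasurableSpace Z] [BorelSpace Z] (ν : Measure Z) [IsLocallyFiniteMeasure ν]
  {H : Type*} [NormedAddCommGroup H] [NormedSpace ℝ H]

theorem HasCompactSupport.continuous_integral_prodMk {F : E × Z → H} (hc : HasCompactSupport F)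
    (hF : Continuous F) : Continuous fun y => ∫ z, F (y, z) ∂ν := by
  have h := continuous_parametric_integral_of_continuous (μ := ν) (f := fun y z => F (y, z))
    (by exact hF) (hc.isCompact.image continuous_snd)
  refine h.congr fun y => setIntegral_eq_integral_of_forall_compl_eq_zero fun z hz => ?_
  by_contra h
  exact hz ⟨(y, z), subset_tsupport F h, rfl⟩

/-- Differentiation under the integral sign for compactly supported integrands. -/
theorem HasCompactSupport.hasFDerivAt_integral_prodMk {F : E × Z → ℝ} (hc : HasCompactSupport F)
    (hF : ContDiff ℝ 1 F) (y : E) :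
    HasFDerivAt (fun y => ∫ z, F (y, z) ∂ν)
      (∫ z, (fderiv ℝ F (y, z)).comp (ContinuousLinearMap.inl ℝ E Z) ∂ν) y := by
  set F' : E × Z → E →L[ℝ] ℝ := fun p => (fderiv ℝ F p).comp (ContinuousLinearMap.inl ℝ E Z)
    with hF'
  have hF'c : Continuous F' := (hF.continuous_fderiv one_ne_zero).clm_comp continuous_const
  have hF's : HasCompactSupport F' :=
    (hc.fderiv ℝ).comp_left (g := fun A : E × Z →L[ℝ] ℝ => A.comp (ContinuousLinearMap.inl ℝ E Z))
      (by simp)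
  obtain ⟨M, hM⟩ := hF's.exists_bound_of_continuous hF'c
  set K : Set Z := Prod.snd '' tsupport F' with hK
  have hKc : IsCompact K := hF's.isCompact.image continuous_snd
  refine hasFDerivAt_integral_of_dominated_of_fderiv_le (bound := K.indicator fun _ => M)
    (F := fun y z => F (y, z)) (F' := fun y z => F' (y, z)) Filter.univ_mem
    (Filter.Eventually.of_forall fun x => ?_) ?_ ?_ (Filter.Eventually.of_forall fun z x _ => ?_)
    ?_ (Filter.Eventually.of_forall fun z x _ => ?_)
  · exact (hF.continuous.comp (by fun_prop)).aestronglyMeasurable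
  · exact (hF.continuous.comp (by fun_prop)).integrable_of_hasCompactSupport (hc.comp_prodMk_left y)
  · exact (hF'c.comp (by fun_prop)).aestronglyMeasurable
  · by_cases hz : z ∈ K
    · simpa [hz] using hM (x, z)
    · have : F' (x, z) = 0 := by
        by_contra h
        exact hz ⟨(x, z), subset_tsupport F' h, rfl⟩
      simp [hz, this]
  · exact (integrable_indicator_iff hKc.measurableSet).2
      (integrableOn_const hKc.measure_lt_top.ne)
  · exact (hF.differentiable one_ne_zero (x, z)).hasFDerivAt.comp x
      (hasFDerivAt_prodMk_left x z)

theorem HasCompactSupport.contDiff_integral_prodMk {F : E × Z → ℝ} (hc : HasCompactSupport F)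
    (hF : ContDiff ℝ 1 F) : ContDiff ℝ 1 fun y => ∫ z, F (y, z) ∂ν := by
  rw [contDiff_one_iff_fderiv]
  refine ⟨fun y => (hc.hasFDerivAt_integral_prodMk ν hF y).differentiableAt, ?_⟩
  have : fderiv ℝ (fun y => ∫ z, F (y, z) ∂ν) =
      fun y => ∫ z, (fderiv ℝ F (y, z)).comp (ContinuousLinearMap.inl ℝ E Z) ∂ν :=
    funext fun y => (hc.hasFDerivAt_integral_prodMk ν hF y).fderiv
  rw [this]
  exact HasCompactSupport.continuous_integral_prodMk ν
    (F := fun p => (fderiv ℝ F p).comp (ContinuousLinearMap.inl ℝ E Z))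
    ((hc.fderiv ℝ).comp_left
      (g := fun A : E × Z →L[ℝ] ℝ => A.comp (ContinuousLinearMap.inl ℝ E Z)) (by simp))
    ((hF.continuous_fderiv one_ne_zero).clm_comp continuous_const)

/-- A weighted bound on the derivative of a partial density. -/
theorem HasCompactSupport.abs_fderiv_integral_norm_sq_le {f : E × Z → ℂ}
    (hc : HasCompactSupport f) (hf : ContDiff ℝ 1 f) (y h : E) {c : ℝ} (hc0 : 0 < c) :
    |fderiv ℝ (fun y => ∫ z, ‖f (y, z)‖ ^ 2 ∂ν) y h| ≤
      c * ∫ z, ‖f (y, z)‖ ^ 2 ∂ν + c⁻¹ * ∫ z, ‖fderiv ℝ f (y, z) (h, 0)‖ ^ 2 ∂ν := by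
  have hF : ContDiff ℝ 1 fun p => ‖f p‖ ^ 2 := hf.norm_sq ℝ
  have hd := hc.norm_sq.hasFDerivAt_integral_prodMk ν hF y
  have hcd := hf.continuous_fderiv one_ne_zero
  have hi1 : Integrable (fun z => ‖f (y, z)‖ ^ 2) ν :=
    (hF.continuous.comp (by fun_prop)).integrable_of_hasCompactSupport
      (hc.norm_sq.comp_prodMk_left y)
  have hi2 : Integrable (fun z => ‖fderiv ℝ f (y, z) (h, 0)‖ ^ 2) ν := by
    refine Continuous.integrable_of_hasCompactSupport ?_
      ((hc.fderiv_apply_const (h, 0)).norm_sq.comp_prodMk_left y)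
    exact ((hcd.comp (by fun_prop)).clm_apply continuous_const).norm.pow 2
  have hi3 : Integrable (fun z => (fderiv ℝ (fun p => ‖f p‖ ^ 2) (y, z)).comp
      (ContinuousLinearMap.inl ℝ E Z)) ν := by
    refine Continuous.integrable_of_hasCompactSupport ?_
      (HasCompactSupport.comp_prodMk_left ((hc.norm_sq.fderiv ℝ).comp_left
      (g := fun A : E × Z →L[ℝ] ℝ => A.comp (ContinuousLinearMap.inl ℝ E Z)) (by simp)) y)
    exact ((hF.continuous_fderiv one_ne_zero).comp (by fun_prop)).clm_comp continuous_const
  rw [hd.fderiv, ContinuousLinearMap.integral_apply hi3, ← integral_const_mul,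
    ← integral_const_mul, ← integral_add (hi1.const_mul c) (hi2.const_mul _), ← Real.norm_eq_abs]
  refine norm_integral_le_of_norm_le ((hi1.const_mul c).add (hi2.const_mul _))
    (Filter.Eventually.of_forall fun z => ?_)
  have h1 := (hf.differentiable one_ne_zero (y, z)).hasFDerivAt.norm_sq
  rw [h1.fderiv]
  simp only [ContinuousLinearMap.comp_apply, ContinuousLinearMap.inl_apply,
    smul_apply, innerSL_apply_apply, Real.norm_eq_abs]
  have h2 := abs_real_inner_le_norm (f (y, z)) (fderiv ℝ f (y, z) (h, 0))
  set A := ‖f (y, z)‖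
  set B := ‖fderiv ℝ f (y, z) (h, 0)‖
  have h3 : c * A ^ 2 + c⁻¹ * B ^ 2 - 2 * (A * B) = c⁻¹ * (c * A - B) ^ 2 := by
    field_simp
    ring
  have h4 : 0 ≤ c⁻¹ * (c * A - B) ^ 2 := by positivity
  rw [nsmul_eq_mul, abs_mul]
  simp only [Nat.cast_ofNat, Nat.abs_ofNat]
  linarith

end ParametricIntegral

theorem sq_le_of_forall_weighted_le {X A B : ℝ} (hX : 0 ≤ X) (hA : 0 ≤ A) (hB : 0 ≤ B)
    (h : ∀ c : ℝ, 0 < c → X ≤ c * A + c⁻¹ * B) : X ^ 2 ≤ 4 * A * B := by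
  have key : ∀ c : ℝ, 0 ≤ A * (c * c) + (-X) * c + B := by
    intro c
    rcases le_or_gt c 0 with hc | hc
    · have : 0 ≤ -X * c := by nlinarith
      have : 0 ≤ A * (c * c) := mul_nonneg hA (mul_self_nonneg c)
      linarith
    · have h1 := mul_le_mul_of_nonneg_left (h c hc) hc.le
      rw [mul_add, ← mul_assoc c c⁻¹, mul_inv_cancel₀ hc.ne'] at h1
      linarith
  have := discrim_le_zero key
  rw [discrim] at this
  linarith

theorem EuclideanSpace.norm_sq_apply_le {d : ℕ} {H : Type*} [NormedAddCommGroup H]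
    [NormedSpace ℝ H] (A : EuclideanSpace ℝ (Fin d) →L[ℝ] H) (h : EuclideanSpace ℝ (Fin d)) :
    ‖A h‖ ^ 2 ≤ ‖h‖ ^ 2 * ∑ m, ‖A (EuclideanSpace.single m 1)‖ ^ 2 := by
  have h1 : h = ∑ m, h m • EuclideanSpace.single m (1 : ℝ) := by
    ext i
    simp [Pi.single_apply]
  have h2 : ‖A h‖ ≤ ∑ m, |h m| * ‖A (EuclideanSpace.single m 1)‖ := by
    conv_lhs => rw [h1]
    rw [map_sum]
    refine (norm_sum_le _ _).trans (Finset.sum_le_sum fun m _ => ?_)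
    rw [map_smul, norm_smul, Real.norm_eq_abs]
  calc ‖A h‖ ^ 2 ≤ (∑ m, |h m| * ‖A (EuclideanSpace.single m 1)‖) ^ 2 := by gcongr
    _ ≤ (∑ m, |h m| ^ 2) * ∑ m, ‖A (EuclideanSpace.single m 1)‖ ^ 2 :=
        Finset.sum_mul_sq_le_sq_mul_sq _ _ _
    _ = _ := by rw [EuclideanSpace.norm_sq_eq]; simp

section Cube

variable {d : ℕ} {Q : Set (EuclideanSpace ℝ (Fin d))}

theorem EuclideanSpace.volume_openCube (L : ℝ) :
    volume {x : EuclideanSpace ℝ (Fin d) | ∀ m, x m ∈ Set.Ioo 0 L} = ENNReal.ofReal L ^ d := by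
  have h := (PiLp.volume_preserving_ofLp (Fin d)).measure_preimage
    (s := Set.univ.pi fun _ => Set.Ioo (0 : ℝ) L)
    (MeasurableSet.univ_pi fun _ => measurableSet_Ioo).nullMeasurableSet
  rw [volume_pi_pi] at h
  simp only [Real.volume_Ioo, sub_zero, Finset.prod_const, Finset.card_univ, Fintype.card_fin] at h
  rw [← h]
  congr 1
  ext x
  simp

theorem IsometryEquiv.measurePreserving_euclidean
    (f : EuclideanSpace ℝ (Fin d) ≃ᵢ EuclideanSpace ℝ (Fin d)) :
    MeasurePreserving f volume volume := by
  have h1 : ⇑f = (fun x => x + f 0) ∘ f.toRealLinearIsometryEquiv := by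
    ext1 x
    simp
  rw [h1]
  exact (measurePreserving_add_right volume (f 0)).comp
    f.toRealLinearIsometryEquiv.measurePreserving

/-- A cube is a convex set of finite positive volume and of diameter at most `√d L`. -/
theorem IsCube.exists_side (hQ : IsCube d Q) : ∃ L : ℝ, 0 < L ∧ Convex ℝ Q ∧ MeasurableSet Q ∧
    volume Q = ENNReal.ofReal (L ^ d) ∧ ∀ x ∈ Q, ∀ y ∈ Q, ‖y - x‖ ≤ √d * L := by
  obtain ⟨L, hL, f, rfl⟩ := hQ
  set S := {x : EuclideanSpace ℝ (Fin d) | ∀ m, x m ∈ Set.Ioo 0 L} with hS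
  have hSo : IsOpen S := by
    simp only [hS, Set.ofPred_forall]
    exact isOpen_iInter_of_finite fun m => isOpen_Ioo.preimage (by fun_prop)
  have hSc : Convex ℝ S := by
    intro x hx y hy a b ha hb hab m
    exact convex_Ioo 0 L (hx m) (hy m) ha hb hab
  have hm : MeasurableSet (f '' S) := (f.toHomeomorph.isOpenMap S hSo).measurableSet
  refine ⟨L, hL, ?_, hm, ?_, ?_⟩
  · have := hSc.affine_image f.toRealAffineIsometryEquiv.toAffineEquiv.toAffineMap
    simpa using this
  · rw [← f.measurePreserving_euclidean.measure_preimage hm.nullMeasurableSet,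
      Set.preimage_image_eq _ f.injective, EuclideanSpace.volume_openCube,
      ENNReal.ofReal_pow hL.le]
  · rintro _ ⟨x, hx, rfl⟩ _ ⟨y, hy, rfl⟩
    rw [← dist_eq_norm, f.dist_eq, EuclideanSpace.dist_eq]
    refine Real.sqrt_le_iff.2 ⟨by positivity, ?_⟩
    rw [mul_pow, Real.sq_sqrt (by positivity)]
    calc ∑ i, dist (y i) (x i) ^ 2 ≤ ∑ _i : Fin d, L ^ 2 := by
          refine Finset.sum_le_sum fun i _ => ?_
          have h1 := hx i
          have h2 := hy i
          rw [Real.dist_eq, sq_abs]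
          exact sq_le_sq' (by linarith [h1.1, h1.2, h2.1, h2.2])
            (by linarith [h1.1, h1.2, h2.1, h2.2])
      _ = _ := by simp

end Cube

section Particles

variable {d N : ℕ}

/-- Insertion of a particle at position `y` as the `j`-th coordinate block. -/
def insertParticle (d : ℕ) {N : ℕ} (j : Fin N) :
    EuclideanSpace ℝ (Fin d) × ({k : Fin N // k ≠ j} → EuclideanSpace ℝ (Fin d)) →L[ℝ]
      (Fin N → EuclideanSpace ℝ (Fin d)) :=
  ContinuousLinearMap.pi fun k => if h : k = j then ContinuousLinearMap.fst ℝ _ _ else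
    (ContinuousLinearMap.proj (⟨k, h⟩ : {k : Fin N // k ≠ j})).comp
      (ContinuousLinearMap.snd ℝ _ _)

theorem insertParticle_apply (j : Fin N)
    (p : EuclideanSpace ℝ (Fin d) × ({k : Fin N // k ≠ j} → EuclideanSpace ℝ (Fin d))) :
    insertParticle d j p = fun k => if h : k = j then p.1 else p.2 ⟨k, h⟩ := by
  ext1 k
  by_cases h : k = j <;> simp [insertParticle, h]

theorem insertParticle_same (j : Fin N)
    (p : EuclideanSpace ℝ (Fin d) × ({k : Fin N // k ≠ j} → EuclideanSpace ℝ (Fin d))) :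
    insertParticle d j p j = p.1 := by
  simp [insertParticle_apply]

theorem insertParticle_zero_right (j : Fin N) (y : EuclideanSpace ℝ (Fin d)) :
    insertParticle d j (y, 0) = Pi.single j y := by
  rw [insertParticle_apply]
  ext1 k
  by_cases h : k = j
  · subst h
    simp
  · simp [h]

theorem insertParticle_injective (j : Fin N) : Function.Injective (insertParticle d j) := by
  rintro ⟨y, z⟩ ⟨y', z'⟩ h
  rw [insertParticle_apply, insertParticle_apply] at h
  have h1 := congrFun h j
  simp only [dite_true] at h1
  refine Prod.ext h1 (funext fun k => ?_)
  have h2 := congrFun h k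
  simpa [k.2] using h2

theorem measurePreserving_insertParticle (j : Fin N) :
    MeasurePreserving (insertParticle d j) (volume.prod volume) volume := by
  have h1 : MeasurePreserving (MeasurableEquiv.piEquivPiSubtypeProd
      (fun _ : Fin N => EuclideanSpace ℝ (Fin d)) (fun k => k = j)).symm
      (volume.prod volume) volume := by
    have := (volume_preserving_piEquivPiSubtypeProd
      (fun _ : Fin N => EuclideanSpace ℝ (Fin d)) (fun k => k = j)).symm
    rw [Measure.volume_eq_prod] at this
    convert this
    all_goals rfl
  have h2 := (volume_preserving_piUnique
    (fun _ : {k : Fin N // k = j} => EuclideanSpace ℝ (Fin d))).symm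
  have h3 := h1.comp (h2.prod (MeasurePreserving.id
    (volume : Measure ({k : Fin N // ¬k = j} → EuclideanSpace ℝ (Fin d)))))
  convert h3 using 1
  ext1 p
  rw [insertParticle_apply]
  ext1 k
  by_cases h : k = j
  · subst h
    simp [MeasurableEquiv.piEquivPiSubtypeProd, Equiv.piEquivPiSubtypeProd]
  · simp [MeasurableEquiv.piEquivPiSubtypeProd, Equiv.piEquivPiSubtypeProd, h]

variable {u : (Fin N → EuclideanSpace ℝ (Fin d)) → ℂ}

theorem HasCompactSupport.comp_insertParticle (hc : HasCompactSupport u) (j : Fin N) :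
    HasCompactSupport fun p => u (insertParticle d j p) :=
  hc.comp_isClosedEmbedding
    ((insertParticle d j).toLinearMap.isClosedEmbedding_of_injective
      (LinearMap.ker_eq_bot.2 (insertParticle_injective j)))

theorem fderiv_comp_insertParticle (hu : ContDiff ℝ 1 u) (j : Fin N)
    (p : EuclideanSpace ℝ (Fin d) × ({k : Fin N // k ≠ j} → EuclideanSpace ℝ (Fin d)))
    (h : EuclideanSpace ℝ (Fin d)) :
    fderiv ℝ (fun p => u (insertParticle d j p)) p (h, 0) =
      fderiv ℝ u (insertParticle d j p) (Pi.single j h) := by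
  have := (hu.differentiable one_ne_zero (insertParticle d j p)).hasFDerivAt.comp p
    (insertParticle d j).hasFDerivAt
  have h2 : fderiv ℝ (fun p => u (insertParticle d j p)) p =
    (fderiv ℝ u (insertParticle d j p)).comp (insertParticle d j) := this.fderiv
  rw [h2, ContinuousLinearMap.comp_apply, insertParticle_zero_right]

/-- The squared gradient of `u` in the `j`-th particle. -/
def particleGradSq (u : (Fin N → EuclideanSpace ℝ (Fin d)) → ℂ) (j : Fin N)
    (x : Fin N → EuclideanSpace ℝ (Fin d)) : ℝ :=
  ∑ m : Fin d, ‖fderiv ℝ u x (Pi.single j (EuclideanSpace.single m (1 : ℝ)))‖ ^ 2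

theorem particleGradSq_nonneg (j : Fin N) (x : Fin N → EuclideanSpace ℝ (Fin d)) :
    0 ≤ particleGradSq u j x :=
  Finset.sum_nonneg fun _ _ => sq_nonneg _

theorem continuous_particleGradSq (hu : ContDiff ℝ 1 u) (j : Fin N) :
    Continuous (particleGradSq u j) :=
  continuous_finsetSum _ fun _ _ =>
    ((hu.continuous_fderiv one_ne_zero).clm_apply continuous_const).norm.pow 2

theorem integrable_particleGradSq (hu : ContDiff ℝ 1 u) (hc : HasCompactSupport u) (j : Fin N)
    (y : EuclideanSpace ℝ (Fin d)) :
    Integrable fun z : {k : Fin N // k ≠ j} → EuclideanSpace ℝ (Fin d) =>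
      particleGradSq u j (insertParticle d j (y, z)) := by
  refine integrable_finsetSum _ fun m _ => ?_
  simp_rw [← fderiv_comp_insertParticle hu]
  have hcd : ContDiff ℝ 1 fun p => u (insertParticle d j p) :=
    hu.comp (insertParticle d j).contDiff
  refine Continuous.integrable_of_hasCompactSupport ?_
    (((hc.comp_insertParticle j).fderiv_apply_const _).norm_sq.comp_prodMk_left y)
  exact (((hcd.continuous_fderiv one_ne_zero).comp
    (by fun_prop)).clm_apply continuous_const).norm.pow 2

theorem density_eq (u : (Fin N → EuclideanSpace ℝ (Fin d)) → ℂ) :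
    density d N u = fun y => ∑ j, ∫ z, ‖u (insertParticle d j (y, z))‖ ^ 2 := by
  ext1 y
  simp only [density, insertParticle_apply]

theorem density_nonneg (y : EuclideanSpace ℝ (Fin d)) : 0 ≤ density d N u y :=
  Finset.sum_nonneg fun _ _ => integral_nonneg fun _ => sq_nonneg _

theorem contDiff_partialDensity (hu : ContDiff ℝ 1 u) (hc : HasCompactSupport u) (j : Fin N) :
    ContDiff ℝ 1 fun y => ∫ z, ‖u (insertParticle d j (y, z))‖ ^ 2 :=
  (hc.comp_insertParticle j).norm_sq.contDiff_integral_prodMk volume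
    ((hu.comp (insertParticle d j).contDiff).norm_sq ℝ)

theorem contDiff_density (hu : ContDiff ℝ 1 u) (hc : HasCompactSupport u) :
    ContDiff ℝ 1 (density d N u) := by
  rw [density_eq]
  exact ContDiff.sum fun j _ => contDiff_partialDensity hu hc j

/-- The gradient of the density is controlled by the density and the kinetic energy density. -/
theorem norm_fderiv_density_sq_le (hu : ContDiff ℝ 1 u) (hc : HasCompactSupport u)
    (y : EuclideanSpace ℝ (Fin d)) :
    ‖fderiv ℝ (density d N u) y‖ ^ 2 ≤ 4 * density d N u y *
      ∑ j, ∫ z, particleGradSq u j (insertParticle d j (y, z)) := by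
  set T := ∑ j, ∫ z, particleGradSq u j (insertParticle d j (y, z)) with hT
  have hT0 : 0 ≤ T := Finset.sum_nonneg fun j _ =>
    integral_nonneg fun z => particleGradSq_nonneg _ _
  have hρ0 : 0 ≤ density d N u y := density_nonneg y
  rw [← Real.sqrt_le_sqrt_iff (by positivity), Real.sqrt_sq (norm_nonneg _)]
  refine ContinuousLinearMap.opNorm_le_bound _ (Real.sqrt_nonneg _) fun h => ?_
  refine (sq_le_sq₀ (norm_nonneg _) (by positivity)).1 ?_
  rw [mul_pow, Real.sq_sqrt (by positivity), Real.norm_eq_abs]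
  have key := sq_le_of_forall_weighted_le (X := |fderiv ℝ (density d N u) y h|)
    (A := density d N u y) (B := ‖h‖ ^ 2 * T) (abs_nonneg _) hρ0 (by positivity) ?_
  · linarith
  intro c hc0
  rw [density_eq, fderiv_fun_sum fun j _ =>
    (contDiff_partialDensity hu hc j).differentiable one_ne_zero y, sum_apply]
  refine (Finset.abs_sum_le_sum_abs _ _).trans ?_
  rw [hT, Finset.mul_sum, Finset.mul_sum, Finset.mul_sum, ← Finset.sum_add_distrib]
  refine Finset.sum_le_sum fun j _ => ?_
  refine ((hc.comp_insertParticle j).abs_fderiv_integral_norm_sq_le volume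
    (hu.comp (insertParticle d j).contDiff) y h hc0).trans ?_
  gcongr
  rw [← integral_const_mul]
  refine integral_mono_of_nonneg (Filter.Eventually.of_forall fun z => sq_nonneg _)
    ((integrable_particleGradSq hu hc j y).const_mul _) (Filter.Eventually.of_forall fun z => ?_)
  simp only [fderiv_comp_insertParticle hu]
  exact EuclideanSpace.norm_sq_apply_le ((fderiv ℝ u (insertParticle d j (y, z))).comp
    (ContinuousLinearMap.single ℝ (fun _ : Fin N => EuclideanSpace ℝ (Fin d)) j)) h

/-- The kinetic energy in `Q` as the integral of the kinetic energy density. -/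
theorem sum_lintegral_particleGradSq (hu : ContDiff ℝ 1 u) (hc : HasCompactSupport u)
    {Q : Set (EuclideanSpace ℝ (Fin d))} (hQ : MeasurableSet Q) :
    ∑ j : Fin N, ∫⁻ x : Fin N → EuclideanSpace ℝ (Fin d), ENNReal.ofReal
        (particleGradSq u j x * Q.indicator (fun _ => (1 : ℝ)) (x j)) =
      ∫⁻ y in Q, ENNReal.ofReal (∑ j, ∫ z, particleGradSq u j (insertParticle d j (y, z))) := by
  have hm : ∀ j : Fin N, Measurable (particleGradSq u j) := fun j =>
    (continuous_particleGradSq hu j).measurable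
  have h1 : ∀ y, ENNReal.ofReal (∑ j, ∫ z, particleGradSq u j (insertParticle d j (y, z))) =
      ∑ j, ∫⁻ z, ENNReal.ofReal (particleGradSq u j (insertParticle d j (y, z))) := by
    intro y
    rw [ENNReal.ofReal_sum_of_nonneg fun j _ =>
      integral_nonneg fun z => particleGradSq_nonneg _ _]
    refine Finset.sum_congr rfl fun j _ => ?_
    exact ofReal_integral_eq_lintegral_ofReal (integrable_particleGradSq hu hc j y)
      (Filter.Eventually.of_forall fun z => particleGradSq_nonneg _ _)
  have hmj : ∀ j : Fin N, Measurable fun p : EuclideanSpace ℝ (Fin d) ×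
      ({k : Fin N // k ≠ j} → EuclideanSpace ℝ (Fin d)) =>
      ENNReal.ofReal (particleGradSq u j (insertParticle d j p)) := fun j =>
    ENNReal.measurable_ofReal.comp ((hm j).comp (insertParticle d j).continuous.measurable)
  simp_rw [h1]
  rw [lintegral_finsetSum _ fun j _ => (hmj j).lintegral_prod_right']
  refine Finset.sum_congr rfl fun j _ => ?_
  have hmi : Measurable fun x : Fin N → EuclideanSpace ℝ (Fin d) => ENNReal.ofReal
        (particleGradSq u j x * Q.indicator (fun _ => (1 : ℝ)) (x j)) :=
    ENNReal.measurable_ofReal.comp ((hm j).mul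
      ((measurable_const.indicator hQ).comp (measurable_pi_apply j)))
  have hmi' := hmi.comp (insertParticle d j).continuous.measurable
  simp only [Function.comp_def] at hmi'
  rw [← (measurePreserving_insertParticle j).lintegral_comp hmi, lintegral_prod _ hmi'.aemeasurable,
    ← lintegral_indicator hQ]
  refine lintegral_congr fun y => ?_
  simp only [insertParticle_same]
  by_cases hy : y ∈ Q <;> simp [hy]

end Particles

/-- **Theorem (many-particle Neumann Lieb–Thirring inequality on a cube).** For every
`d ≥ 1` there is a `C_d' > 0` such that for every cube `Q ⊂ ℝ^d`, every `N ≥ 1` and every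
smooth compactly supported `u : (ℝ^d)^N → ℂ` with `∫_Q ρ > 0`, where `ρ` is the
one-particle density of `u`,
`∑_j ∫ |∇_{x_j}u|² χ_Q(x_j) ≥ C_d' (∫_Q ρ)^{-2/d} ∫_Q [ρ^{1/2} − ((∫_Q ρ)/|Q|)^{1/2}]₊^{2(d+2)/d}`. -/
theorem neumann_lieb_thirring_cube_many_particle (d : ℕ) (hd : 1 ≤ d) :
    ∃ C : ℝ, 0 < C ∧
      ∀ Q : Set (EuclideanSpace ℝ (Fin d)), IsCube d Q →
      ∀ N : ℕ, 1 ≤ N →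
      ∀ u : (Fin N → EuclideanSpace ℝ (Fin d)) → ℂ,
        ContDiff ℝ (⊤ : ℕ∞) u → HasCompactSupport u →
      0 < (∫ y in Q, density d N u y) →
      ENNReal.ofReal (C * (∫ y in Q, density d N u y) ^ (-(2 : ℝ) / (d : ℝ)) *
          ∫ y in Q, (max (Real.sqrt (density d N u y) -
              Real.sqrt ((∫ z in Q, density d N u z) / (volume Q).toReal)) 0) ^
            (2 * ((d : ℝ) + 2) / (d : ℝ))) ≤
        ∑ j : Fin N, ∫⁻ x : Fin N → EuclideanSpace ℝ (Fin d), ENNReal.ofReal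
          ((∑ m : Fin d,
            ‖fderiv ℝ u x (Pi.single j (EuclideanSpace.single m (1 : ℝ)))‖ ^ 2) *
            Set.indicator Q (fun _ => (1 : ℝ)) (x j)) := by
  have hdR : (0 : ℝ) < d := by exact_mod_cast hd
  obtain ⟨K, hK, hmain⟩ := exists_setLIntegral_sqrt_sub_posPart_rpow_le d hd
  refine ⟨(K * d)⁻¹, by positivity, ?_⟩
  intro Q hQ N _ u hu' hc hI
  have hu : ContDiff ℝ 1 u := hu'.of_le (by exact_mod_cast le_top)
  obtain ⟨L, hL, hconv, hmeas, hvol, hdiam⟩ := hQ.exists_side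
  set I := ∫ y in Q, density d N u y with hIdef
  have hint : IntegrableOn (density d N u) Q := by
    by_contra h
    exact hI.ne' (integral_undef h)
  have hLd : 0 < L ^ d := by positivity
  have hvr : (volume Q).toReal = L ^ d := by rw [hvol, ENNReal.toReal_ofReal hLd.le]
  rw [hvr]
  set a := √(I / L ^ d) with ha
  have ha2 : a ^ 2 = I / L ^ d := Real.sq_sqrt (by positivity)
  have hapos : 0 < a := Real.sqrt_pos.2 (by positivity)
  have hρc := contDiff_density hu hc
  have h1 := hmain (volume : Measure (EuclideanSpace ℝ (Fin d))) (by simp) (Q := Q)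
    (D := √d * L) (a := a) (ρ := density d N u)
    (G := fun y => ENNReal.ofReal (∑ j, ∫ z, particleGradSq u j (insertParticle d j (y, z))))
    hconv hmeas (by rw [hvol]; simpa using hLd) (by rw [hvol]; exact ENNReal.ofReal_ne_top)
    hdiam hapos hρc density_nonneg
    (fun y => by
      have := density_nonneg (u := u) y
      rw [← ofReal_norm, ← ENNReal.ofReal_pow (norm_nonneg _),
        ← ENNReal.ofReal_mul (by positivity)]
      exact ENNReal.ofReal_le_ofReal (norm_fderiv_density_sq_le hu hc y))
    (by
      rw [← ofReal_integral_eq_lintegral_ofReal hint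
        (Filter.Eventually.of_forall density_nonneg), hvol,
        ← ENNReal.ofReal_mul (sq_nonneg _), ha2, div_mul_cancel₀ _ hLd.ne'])
  rw [← sum_lintegral_particleGradSq hu hc hmeas] at h1
  have hexp : 2 * ((d : ℝ) + 2) / d = 2 + 4 / d := by
    field_simp
    ring
  have hscale : a ^ (4 / (d : ℝ)) * L ^ 2 = I ^ (2 / (d : ℝ)) := by
    rw [show 4 / (d : ℝ) = ((2 : ℕ) : ℝ) * (2 / d) by push_cast; ring,
      Real.rpow_mul hapos.le, Real.rpow_natCast, ha2, Real.div_rpow hI.le hLd.le,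
      ← Real.rpow_natCast L d, ← Real.rpow_mul hL.le, mul_div_cancel₀ _ hdR.ne', Real.rpow_two]
    field_simp
  have hconst : (K * d)⁻¹ * I ^ (-(2 : ℝ) / d) * (K * a ^ (4 / (d : ℝ)) * (√d * L) ^ 2) = 1 := by
    rw [mul_pow, Real.sq_sqrt hdR.le,
      show K * a ^ (4 / (d : ℝ)) * (d * L ^ 2) = K * d * (a ^ (4 / (d : ℝ)) * L ^ 2) by ring,
      hscale, neg_div, Real.rpow_neg hI.le]
    have : 0 < I ^ (2 / (d : ℝ)) := by positivity
    field_simp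
  have h2 : ENNReal.ofReal (∫ y in Q, max (√(density d N u y) - a) 0 ^ (2 + 4 / (d : ℝ))) ≤
      ∫⁻ y in Q, ENNReal.ofReal (max (√(density d N u y) - a) 0 ^ (2 + 4 / (d : ℝ))) := by
    have hmρ := hρc.continuous.measurable
    rw [integral_eq_lintegral_of_nonneg_ae
      (Filter.Eventually.of_forall fun y => Real.rpow_nonneg (le_max_right _ _) _)
      (Measurable.aestronglyMeasurable (by fun_prop))]
    exact ENNReal.ofReal_toReal_le
  rw [hexp, ENNReal.ofReal_mul (by positivity)]
  calc _ ≤ ENNReal.ofReal ((K * d)⁻¹ * I ^ (-(2 : ℝ) / d)) *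
        (ENNReal.ofReal (K * a ^ (4 / (d : ℝ)) * (√d * L) ^ 2) *
          ∑ j : Fin N, ∫⁻ x : Fin N → EuclideanSpace ℝ (Fin d), ENNReal.ofReal
            (particleGradSq u j x * Q.indicator (fun _ => (1 : ℝ)) (x j))) :=
        mul_le_mul' le_rfl (h2.trans h1)
    _ = _ := by
        rw [← mul_assoc, ← ENNReal.ofReal_mul (by positivity), hconst, ENNReal.ofReal_one, one_mul]
        rfl

end
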